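/- For all integers k and m with m−1 > k > 1, and every real number q with 0 < q < 1, the plurality with runoff rule satisfies the (q,k,m)-majority criterion if and only if q ≥ k/(k+2). -/

import Mathlib

open Finset
open scoped Classical

noncomputable section

/-- A preference profile: each of the `n` voters has a ranking of the `m`
candidates, given as a bijection sending each candidate to its rank
(rank `0` is the best).  Voter `i` prefers `a` to `b` iff `P i a < P i b`. -/
abbrev Profile (m n : ℕ) := Fin n → (Fin m ≃ Fin m)

namespace Voting

variable {m n : ℕ}

/-- `h(a,b)`: the number of voters who prefer candidate `a` to candidate `b`. -/
def pairs (P : Profile m n) (a b : Fin m) : ℕ :=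
  (Finset.univ.filter fun i => P i a < P i b).card

/-- `n_1(a)`: the number of voters who rank candidate `a` first. -/
def firstCount (P : Profile m n) (a : Fin m) : ℕ :=
  (Finset.univ.filter fun i => ∀ b, b ≠ a → P i a < P i b).card

/-- `n_m(a)`: the number of voters who rank candidate `a` last. -/
def lastCount (P : Profile m n) (a : Fin m) : ℕ :=
  (Finset.univ.filter fun i => ∀ b, b ≠ a → P i b < P i a).card

/-- The number of voters who give the set `B` the top `|B|` positions. -/
def topSupporters (P : Profile m n) (B : Finset (Fin m)) : ℕ :=
  (Finset.univ.filter fun i => ∀ a ∈ B, ∀ b ∉ B, P i a < P i b).card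

/-- The `(q,k,m)`-majority criterion for a voting rule with `m` candidates:
for every number of voters `n ≥ 1`, every profile, and every `k`-element set `B`
of candidates such that strictly more than `q·n` voters give `B` the top `k`
positions, every winner belongs to `B`. -/
def MajorityCriterion (m k : ℕ) (q : ℝ)
    (rule : (n : ℕ) → Profile m n → Finset (Fin m)) : Prop :=
  ∀ n : ℕ, 1 ≤ n → ∀ P : Profile m n, ∀ B : Finset (Fin m),
    B.card = k → q * (n : ℝ) < (topSupporters P B : ℝ) → rule n P ⊆ B

/-- The plurality with runoff rule: `w` wins iff for some `z ≠ w`, `w` and `z`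
have the two highest numbers of first positions and `h(w,z) ≥ h(z,w)`. -/
def runoffWinners (P : Profile m n) : Finset (Fin m) :=
  Finset.univ.filter fun w => ∃ z, z ≠ w ∧
    (∀ x, x ≠ w → x ≠ z → firstCount P x ≤ firstCount P w ∧
      firstCount P x ≤ firstCount P z) ∧
    pairs P z w ≤ pairs P w z

/-- The supporters of a nonempty `B` all rank some member of `B` first. -/
lemma topSupporters_le_sum_firstCount (P : Profile m n) {B : Finset (Fin m)}
    (hB : B.Nonempty) : topSupporters P B ≤ ∑ a ∈ B, firstCount P a := by
  refine le_trans (Finset.card_le_card ?_) Finset.card_biUnion_le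
  intro i hi
  simp only [mem_filter, mem_univ, true_and, mem_biUnion] at hi ⊢
  obtain ⟨a, ha, hmin⟩ := B.exists_min_image (P i) hB
  refine ⟨a, ha, fun b hb => ?_⟩
  by_cases hbB : b ∈ B
  · exact lt_of_le_of_ne (hmin b hbB) fun h => hb ((P i).injective h).symm
  · exact hi a ha b hbB

/-- Voters ranking one of two candidates outside `B` first do not support `B`. -/
lemma firstCount_add_firstCount_add_topSupporters_le (P : Profile m n)
    {B : Finset (Fin m)} (hB : B.Nonempty) {w z : Fin m} (hzw : z ≠ w)
    (hw : w ∉ B) (hz : z ∉ B) :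
    firstCount P w + firstCount P z + topSupporters P B ≤ n := by
  obtain ⟨a, ha⟩ := hB
  have hwz : Disjoint (univ.filter fun i => ∀ b, b ≠ w → P i w < P i b)
      (univ.filter fun i => ∀ b, b ≠ z → P i z < P i b) :=
    Finset.disjoint_filter.2 fun i _ h1 h2 => lt_asymm (h1 z hzw) (h2 w hzw.symm)
  have hout : ∀ c ∉ B, Disjoint (univ.filter fun i => ∀ b, b ≠ c → P i c < P i b)
      (univ.filter fun i => ∀ a ∈ B, ∀ b ∉ B, P i a < P i b) := fun c hc =>
    Finset.disjoint_filter.2 fun i _ h1 h2 =>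
      lt_asymm (h1 a fun h => hc (h ▸ ha)) (h2 a ha c hc)
  have h := Finset.card_le_univ (((univ.filter fun i => ∀ b, b ≠ w → P i w < P i b) ∪
    (univ.filter fun i => ∀ b, b ≠ z → P i z < P i b)) ∪
    (univ.filter fun i => ∀ a ∈ B, ∀ b ∉ B, P i a < P i b))
  rwa [Finset.card_union_of_disjoint (Finset.disjoint_union_left.2 ⟨hout w hw, hout z hz⟩),
    Finset.card_union_of_disjoint hwz, Fintype.card_fin] at h

/-- No voter prefers both `a` to `b` and `b` to `a`. -/
lemma pairs_add_pairs_le (P : Profile m n) (a b : Fin m) :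
    pairs P a b + pairs P b a ≤ n := by
  have hd : Disjoint (univ.filter fun i => P i a < P i b)
      (univ.filter fun i => P i b < P i a) :=
    Finset.disjoint_filter.2 fun i _ h1 h2 => lt_asymm h1 h2
  have h := Finset.card_le_univ ((univ.filter fun i => P i a < P i b) ∪
    (univ.filter fun i => P i b < P i a))
  rwa [Finset.card_union_of_disjoint hd, Fintype.card_fin] at h

lemma topSupporters_le_pairs (P : Profile m n) {B : Finset (Fin m)} {a b : Fin m}
    (ha : a ∈ B) (hb : b ∉ B) : topSupporters P B ≤ pairs P a b :=
  Finset.card_le_card fun i hi => by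
    simp only [mem_filter, mem_univ, true_and] at hi ⊢
    exact hi a ha b hb

/-- If a candidate outside `B` wins the runoff, then `B` has at most `k n / (k + 2)`
supporters, where `k = |B|`. -/
lemma topSupporters_mul_le_of_mem_runoffWinners (P : Profile m n) {B : Finset (Fin m)}
    (hB : 1 < B.card) {w : Fin m} (hw : w ∈ runoffWinners P) (hwB : w ∉ B) :
    (B.card + 2) * topSupporters P B ≤ B.card * n := by
  have hne : B.Nonempty := Finset.card_pos.1 (by omega)
  simp only [runoffWinners, mem_filter, mem_univ, true_and] at hw
  obtain ⟨z, hzw, htop, hpairs⟩ := hw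
  by_cases hzB : z ∈ B
  · have h1 := topSupporters_le_pairs P hzB hwB
    have h2 := pairs_add_pairs_le P z w
    have h3 : 2 * topSupporters P B ≤ n := by omega
    nlinarith
  · have hx : ∀ x ∈ B, x ≠ w ∧ x ≠ z := fun x hx =>
      ⟨fun h => hwB (h ▸ hx), fun h => hzB (h ▸ hx)⟩
    have hS := topSupporters_le_sum_firstCount P hne
    have h1 := Finset.sum_le_card_nsmul B (firstCount P) (firstCount P w)
      fun x h => (htop x (hx x h).1 (hx x h).2).1
    have h2 := Finset.sum_le_card_nsmul B (firstCount P) (firstCount P z)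
      fun x h => (htop x (hx x h).1 (hx x h).2).2
    have h3 := firstCount_add_firstCount_add_topSupporters_le P hne hzw hwB hzB
    rw [smul_eq_mul] at h1 h2
    nlinarith [Nat.mul_le_mul_left B.card h3]

/-- The profile with one voter for each of the first `r` candidates: voter `i` exchanges
candidate `i` with candidate `0` in the ranking `0, 1, …, m - 1`. -/
def swapProfile {r : ℕ} (hr : r ≤ m) (hm : 0 < m) : Profile m r :=
  fun i => Equiv.swap ⟨0, hm⟩ (Fin.castLE hr i)

lemma forall_swap_lt_iff (hm : 0 < m) (c d : Fin m) :
    (∀ b, b ≠ c → Equiv.swap ⟨0, hm⟩ d c < Equiv.swap ⟨0, hm⟩ d b) ↔ d = c := by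
  constructor
  · intro h
    by_contra hdc
    have := h d hdc
    rw [Equiv.swap_apply_right] at this
    exact absurd this (by simp [Fin.lt_def])
  · rintro rfl b hb
    rw [Equiv.swap_apply_right]
    refine lt_of_le_of_ne (by simp [Fin.le_def]) fun h => hb ?_
    exact (Equiv.injective _ ((Equiv.swap_apply_right _ _).trans h)).symm

lemma firstCount_swapProfile {r : ℕ} (hr : r ≤ m) (hm : 0 < m) (c : Fin m) :
    firstCount (swapProfile hr hm) c = if (c : ℕ) < r then 1 else 0 := by
  simp only [firstCount, swapProfile, forall_swap_lt_iff]
  split_ifs with hc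
  · rw [Finset.card_eq_one]
    refine ⟨⟨c, hc⟩, ?_⟩
    ext i
    simp [Fin.ext_iff]
  · rw [Finset.card_eq_zero, Finset.filter_eq_empty_iff]
    rintro i - rfl
    exact hc i.isLt

lemma le_topSupporters_swapProfile {r k : ℕ} (hr : r ≤ m) (hm : 0 < m) (hk : k ≤ r) :
    k ≤ topSupporters (swapProfile hr hm) (univ.filter fun c : Fin m => (c : ℕ) < k) := by
  have h : (univ.map (Fin.castLEEmb hk)).card ≤ _ := Finset.card_le_card
    (t := univ.filter fun i : Fin r => ∀ a ∈ univ.filter fun c : Fin m => (c : ℕ) < k,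
      ∀ b ∉ univ.filter fun c : Fin m => (c : ℕ) < k,
        swapProfile hr hm i a < swapProfile hr hm i b) ?_
  · rwa [Finset.card_map, Finset.card_univ, Fintype.card_fin] at h
  · intro i hi
    simp only [mem_map, mem_univ, true_and, mem_filter, not_lt] at hi ⊢
    obtain ⟨j, rfl⟩ := hi
    intro a ha b hb
    have hj := j.isLt
    have hbfix : swapProfile hr hm (Fin.castLEEmb hk j) b = b := by
      refine Equiv.swap_apply_of_ne_of_ne (fun h => ?_) (fun h => ?_) <;>
        have hv := congrArg Fin.val h <;> simp at hv <;> omega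
    rw [hbfix]
    simp only [swapProfile, Equiv.swap_apply_def]
    split_ifs <;> rw [Fin.lt_def] <;> try simp only [Fin.val_castLE, Fin.castLEEmb_apply]
    all_goals omega

/-- With one voter for each of the first `r` candidates, any two of them may meet in the
runoff. -/
lemma mem_runoffWinners_swapProfile {r : ℕ} (hr : r ≤ m) (hm : 0 < m) {w z : Fin m}
    (hzw : z ≠ w) (hw : (w : ℕ) < r) (hz : (z : ℕ) < r)
    (h : pairs (swapProfile hr hm) z w ≤ pairs (swapProfile hr hm) w z) :
    w ∈ runoffWinners (swapProfile hr hm) := by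
  simp only [runoffWinners, mem_filter, mem_univ, true_and]
  refine ⟨z, hzw, fun x _ _ => ?_, h⟩
  simp only [firstCount_swapProfile, hw, hz, if_true]
  split_ifs <;> simp

/-- For all integers `m − 1 > k > 1` and every real `q` with `0 < q < 1`, the
plurality with runoff rule satisfies the `(q,k,m)`-majority criterion iff
`q ≥ k/(k+2)`. -/
theorem runoff_qkm_majority (m k : ℕ) (hk : 1 < k) (hm : k + 1 < m)
    (q : ℝ) (hq0 : 0 < q) (hq1 : q < 1) :
    MajorityCriterion m k q (fun n P => runoffWinners P) ↔
      (k : ℝ) / ((k : ℝ) + 2) ≤ q := by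
  have hk2 : (0 : ℝ) < (k : ℝ) + 2 := by positivity
  constructor
  · intro h
    by_contra! hlt
    rw [lt_div_iff₀ hk2] at hlt
    have hr : k + 2 ≤ m := hm
    have hm0 : 0 < m := by omega
    let B : Finset (Fin m) := univ.filter fun c => (c : ℕ) < k
    have hB : B.card = k := by
      rw [Fin.card_filter_val_lt]; omega
    have hsupp : (k : ℝ) ≤ topSupporters (swapProfile hr hm0) B := by
      exact_mod_cast le_topSupporters_swapProfile hr hm0 (Nat.le_add_right k 2)
    have hsub := h (k + 2) (by omega) (swapProfile hr hm0) B hB (by push_cast; linarith)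
    let w : Fin m := ⟨k, by omega⟩
    let z : Fin m := ⟨k + 1, hm⟩
    have hzw : z ≠ w := by simp [w, z]
    rcases le_total (pairs (swapProfile hr hm0) z w) (pairs (swapProfile hr hm0) w z)
      with hp | hp
    · have := hsub (mem_runoffWinners_swapProfile hr hm0 hzw (by simp [w]) (by simp [z]) hp)
      simp [B, w] at this
    · have := hsub
        (mem_runoffWinners_swapProfile hr hm0 hzw.symm (by simp [z]) (by simp [w]) hp)
      simp [B, z] at this
  · intro hq n _ P B hB hS w hw
    by_contra hwB
    have h := topSupporters_mul_le_of_mem_runoffWinners P (by omega) hw hwB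
    rw [hB] at h
    have h' : ((k : ℝ) + 2) * topSupporters P B ≤ k * n := by exact_mod_cast h
    rw [div_le_iff₀ hk2] at hq
    nlinarith [mul_le_mul_of_nonneg_right hq (Nat.cast_nonneg (α := ℝ) n),
      mul_lt_mul_of_pos_left hS hk2]

end Voting
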